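/- Let f : ℕ → ℕ be an unbounded nondecreasing function, and suppose there exists a constant M ∈ ℕ such that f(Mn) ≥ 9·f(n) for all n ∈ ℕ. Then there exists a lawless group Γ generated by a finite set S such that 𝒜_Γ^S ≈ f. -/

import Mathlib

/-- The length of the reduced word representing an element of the free group. -/
def wordLen {k : ℕ} (w : FreeGroup (Fin k)) : ℕ := w.toWord.length

/-- `w ∈ F_k` is a law for `Γ` if it vanishes under every evaluation in `Γ`. -/
def IsLaw (Γ : Type*) [Group Γ] {k : ℕ} (w : FreeGroup (Fin k)) : Prop :=
  ∀ g : Fin k → Γ, FreeGroup.lift g w = 1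

/-- A group is lawless if for every `k` no nontrivial element of `F_k` is a law for it. -/
def IsLawless (Γ : Type*) [Group Γ] : Prop :=
  ∀ (k : ℕ) (w : FreeGroup (Fin k)), w ≠ 1 → ¬ IsLaw Γ w

/-- Word length of `g` with respect to a generating set `S`: the least `n` such that `g`
is a product of `n` elements of `S ∪ S⁻¹`. -/
noncomputable def wlen {Γ : Type*} [Group Γ] (S : Set Γ) (g : Γ) : ℕ :=
  sInf {n | ∃ f : Fin n → Γ, (∀ i, f i ∈ S ∨ (f i)⁻¹ ∈ S) ∧ (List.ofFn f).prod = g}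

/-- The complexity `χ_Γ^S(w)`: the least total word length of a tuple on which `w`
does not vanish. -/
noncomputable def chi {Γ : Type*} [Group Γ] (S : Set Γ) {k : ℕ} (w : FreeGroup (Fin k)) : ℕ :=
  sInf {c | ∃ g : Fin k → Γ, FreeGroup.lift g w ≠ 1 ∧ c = ∑ i, wlen S (g i)}

/-- The lawlessness growth function `𝒜_Γ^S`. -/
noncomputable def lawGrowth {Γ : Type*} [Group Γ] (S : Set Γ) (l : ℕ) : ℕ :=
  sSup {c | ∃ w : FreeGroup (Fin 2), w ≠ 1 ∧ wordLen w ≤ l ∧ c = chi S w}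

/-- `F₁ ⪯ F₂` : there is `K ∈ ℕ` with `F₁(l) ≤ K·F₂(K·l)` for all `l`. -/
def Preceq (F₁ F₂ : ℕ → ℕ) : Prop :=
  ∃ K : ℕ, 1 ≤ K ∧ ∀ l : ℕ, 1 ≤ l → F₁ l ≤ K * F₂ (K * l)

/-- Equivalence of growth functions. -/
def EquivGrowth (F₁ F₂ : ℕ → ℕ) : Prop := Preceq F₁ F₂ ∧ Preceq F₂ F₁

namespace LawlessGrowth

open SemidirectProduct
open scoped commutatorElement

/-- The shift action of `ℤ` on the free group on `ι × ℤ`. -/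
def shiftAut (ι : Type*) : Multiplicative ℤ →* MulAut (FreeGroup (ι × ℤ)) where
  toFun n := FreeGroup.freeGroupCongr
    (Equiv.prodCongr (Equiv.refl ι) (Equiv.addRight (Multiplicative.toAdd n)))
  map_one' := by
    ext x
    simp only [toAdd_one, MulAut.one_apply]
    induction x using FreeGroup.induction_on <;> simp_all
  map_mul' m n := by
    ext x
    simp only [toAdd_mul, MulAut.mul_apply]
    induction x using FreeGroup.induction_on with
    | of p => simp [Prod.map, add_left_comm, add_comm]
    | _ => simp_all

@[simp]
lemma shiftAut_of {ι : Type*} (n : Multiplicative ℤ) (c : ι) (k : ℤ) :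
    shiftAut ι n (FreeGroup.of (c, k)) = FreeGroup.of (c, k + Multiplicative.toAdd n) := by
  simp [shiftAut]

lemma norm_shiftAut_le {ι : Type*} [DecidableEq ι] (n : Multiplicative ℤ)
    (x : FreeGroup (ι × ℤ)) : (shiftAut ι n x).norm ≤ x.norm := by
  obtain ⟨L, hL⟩ : ∃ L, L = x.toWord := ⟨_, rfl⟩
  have hx : x = FreeGroup.mk L := by rw [hL, FreeGroup.mk_toWord]
  calc (shiftAut ι n x).norm ≤ L.length := by
        rw [hx]
        refine FreeGroup.norm_mk_le.trans (le_of_eq ?_)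
        simp
    _ = x.norm := by rw [hL]; rfl

/-- The Reidemeister–Schreier embedding of a free group, splitting off the exponent sum of the
letter `a`. -/
noncomputable def splitLetter {ι : Type*} [DecidableEq ι] (a : ι) :
    FreeGroup ι →* FreeGroup (ι × ℤ) ⋊[shiftAut ι] Multiplicative ℤ :=
  FreeGroup.lift fun c ↦
    if c = a then inr (Multiplicative.ofAdd 1) else inl (FreeGroup.of (c, 0))

section splitLetter

variable {ι : Type*} [DecidableEq ι] (a : ι)

lemma splitLetter_of_self :
    splitLetter a (FreeGroup.of a) = inr (Multiplicative.ofAdd 1) := by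
  simp [splitLetter]

lemma splitLetter_of_ne {c : ι} (hc : c ≠ a) :
    splitLetter a (FreeGroup.of c) = inl (FreeGroup.of (c, 0)) := by
  simp [splitLetter, hc]

lemma splitLetter_injective : Function.Injective (splitLetter a) := by
  let fn : FreeGroup (ι × ℤ) →* FreeGroup ι := FreeGroup.lift fun p ↦
    FreeGroup.of a ^ p.2 * FreeGroup.of p.1 * (FreeGroup.of a ^ p.2)⁻¹
  let fg : Multiplicative ℤ →* FreeGroup ι := zpowersHom _ (FreeGroup.of a)
  let r : FreeGroup (ι × ℤ) ⋊[shiftAut ι] Multiplicative ℤ →* FreeGroup ι :=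
    SemidirectProduct.lift fn fg fun n ↦ by
      ext p
      obtain ⟨c, k⟩ := p
      simp only [fn, fg, MonoidHom.comp_apply, MulEquiv.coe_toMonoidHom, shiftAut_of,
        FreeGroup.lift_apply_of, MulAut.conj_apply, zpowersHom_apply]
      rw [add_comm, zpow_add]
      group
  have hr : r.comp (splitLetter a) = MonoidHom.id _ := by
    ext c
    by_cases hc : c = a
    · subst hc
      simp [splitLetter_of_self, r, fg]
    · simp [splitLetter_of_ne a hc, r, fn]
  intro x y hxy
  simpa using (DFunLike.congr_fun hr x).symm.trans ((congrArg r hxy).trans (DFunLike.congr_fun hr y))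

lemma norm_splitLetter_left_le (L : List (ι × Bool)) :
    (splitLetter a (FreeGroup.mk L)).left.norm ≤ (L.filter fun p ↦ p.1 ≠ a).length := by
  induction L with
  | nil => simp [← FreeGroup.one_eq_mk]
  | cons p L ih =>
    obtain ⟨c, b⟩ := p
    rw [show FreeGroup.mk ((c, b) :: L) = FreeGroup.mk [(c, b)] * FreeGroup.mk L by simp, map_mul,
      mul_left]
    refine (FreeGroup.norm_mul_le _ _).trans ?_
    have h := norm_shiftAut_le (splitLetter a (FreeGroup.mk [(c, b)])).right
      (splitLetter a (FreeGroup.mk L)).left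
    have h' : (splitLetter a (FreeGroup.mk [(c, b)])).left.norm ≤ if c = a then 0 else 1 := by
      by_cases hc : c = a
      · cases b <;> simp [splitLetter, hc]
      · cases b <;> simp [splitLetter, hc]
    by_cases hc : c = a
    · rw [if_pos hc] at h'
      rw [List.filter_cons_of_neg (by simpa using hc)]
      omega
    · rw [if_neg hc] at h'
      rw [List.filter_cons_of_pos (by simpa using hc), List.length_cons]
      omega

end splitLetter

lemma derivedSeries_semidirect_le {N G : Type*} [Group N] [CommGroup G] (φ : G →* MulAut N)
    (n : ℕ) : derivedSeries (N ⋊[φ] G) (n + 1) ≤ (derivedSeries N n).map inl := by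
  induction n with
  | zero =>
    rw [zero_add, derivedSeries_one, derivedSeries_zero, ← MonoidHom.range_eq_map,
      range_inl_eq_ker_rightHom]
    exact Abelianization.commutator_subset_ker _
  | succ n ih =>
    rw [derivedSeries_succ, derivedSeries_succ N, Subgroup.map_commutator]
    exact Subgroup.commutator_mono ih ih

lemma map_derivedSeries_le_succ {G H : Type*} [Group G] [Group H] (f : G →* H)
    (hf : ∀ x, f x ∈ commutator H) (n : ℕ) :
    (derivedSeries G n).map f ≤ derivedSeries H (n + 1) := by
  induction n with
  | zero =>
    rw [zero_add, derivedSeries_one]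
    rintro _ ⟨x, -, rfl⟩
    exact hf x
  | succ n ih =>
    rw [derivedSeries_succ, derivedSeries_succ H, Subgroup.map_commutator]
    exact Subgroup.commutator_mono ih ih

/-- Quantitative residual solvability of free groups. -/
lemma eq_one_of_mem_derivedSeries (m : ℕ) : ∀ (ι : Type) [DecidableEq ι] (w : FreeGroup ι),
    w.norm ≤ m → w ∈ derivedSeries (FreeGroup ι) m → w = 1 := by
  induction m with
  | zero =>
    intro ι _ w hw _
    exact FreeGroup.norm_eq_zero.1 (Nat.le_zero.1 hw)
  | succ m ih =>
    intro ι _ w hw hmem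
    by_contra hne
    obtain ⟨p, L, hL⟩ := List.exists_cons_of_ne_nil (mt FreeGroup.toWord_eq_nil_iff.1 hne)
    obtain ⟨v, hv, hvw⟩ := derivedSeries_semidirect_le (shiftAut ι) m
      (map_derivedSeries_le_derivedSeries (splitLetter p.1) (m + 1) ⟨w, hmem, rfl⟩)
    have hnorm : v.norm ≤ m := by
      have h := norm_splitLetter_left_le p.1 w.toWord
      rw [FreeGroup.mk_toWord, ← hvw, left_inl, hL] at h
      have h2 : w.norm = L.length + 1 := by rw [FreeGroup.norm, hL]; rfl
      have h3 := List.length_filter_le (fun q ↦ decide (q.1 ≠ p.1)) L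
      simp only [ne_eq, not_true_eq_false, decide_false, Bool.false_eq_true, not_false_eq_true,
        List.filter_cons_of_neg] at h h3
      omega
    rw [ih _ v hnorm hv, map_one] at hvw
    exact hne (splitLetter_injective p.1 (by rw [map_one, ← hvw]))

lemma norm_map_le {α β : Type*} [DecidableEq α] [DecidableEq β] (f : FreeGroup α →* FreeGroup β)
    {C : ℕ} (hf : ∀ a, (f (FreeGroup.of a)).norm ≤ C) (w : FreeGroup α) :
    (f w).norm ≤ C * w.norm := by
  suffices h : ∀ L : List (α × Bool), (f (FreeGroup.mk L)).norm ≤ C * L.length by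
    have hw := h w.toWord
    rwa [FreeGroup.mk_toWord] at hw
  intro L
  induction L with
  | nil => simp [← FreeGroup.one_eq_mk]
  | cons p L ih =>
    obtain ⟨a, b⟩ := p
    rw [show FreeGroup.mk ((a, b) :: L) = FreeGroup.mk [(a, b)] * FreeGroup.mk L by simp, map_mul,
      List.length_cons, mul_add, mul_one, add_comm]
    refine (FreeGroup.norm_mul_le _ _).trans (Nat.add_le_add ?_ ih)
    cases b
    · rw [show FreeGroup.mk [(a, false)] = (FreeGroup.of a)⁻¹ from rfl, map_inv,
        FreeGroup.norm_inv_eq]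
      exact hf a
    · exact hf a

/-- An injective endomorphism of the free group of rank two with image in the commutator
subgroup. -/
def twist : FreeGroup (Fin 2) →* FreeGroup (Fin 2) :=
  FreeGroup.lift ![⁅(FreeGroup.of 0 : FreeGroup (Fin 2)), FreeGroup.of 1⁆,
    ⁅(FreeGroup.of 0 ^ 2 : FreeGroup (Fin 2)), FreeGroup.of 1⁆]

lemma twist_zero :
    twist (FreeGroup.of 0) = ⁅(FreeGroup.of 0 : FreeGroup (Fin 2)), FreeGroup.of 1⁆ := by
  simp [twist]

lemma twist_one :
    twist (FreeGroup.of 1) = ⁅(FreeGroup.of 0 ^ 2 : FreeGroup (Fin 2)), FreeGroup.of 1⁆ := by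
  simp [twist]

lemma splitLetter_conj (n : ℕ) :
    splitLetter (0 : Fin 2) (FreeGroup.of 0 ^ n * FreeGroup.of 1 * (FreeGroup.of 0 ^ n)⁻¹) =
      inl (FreeGroup.of (1, (n : ℤ))) := by
  have h := (inl_aut (φ := shiftAut (Fin 2)) (Multiplicative.ofAdd (n : ℤ))
    (FreeGroup.of (1, 0))).symm
  rw [shiftAut_of, toAdd_ofAdd, zero_add] at h
  rw [← h, map_mul, map_mul, map_inv, map_pow, splitLetter_of_self,
    splitLetter_of_ne 0 (by decide : (1 : Fin 2) ≠ 0), ← map_pow, ← map_inv, ← ofAdd_nsmul]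
  simp

lemma twist_injective : Function.Injective twist := by
  let s : FreeGroup (Fin 2) →* FreeGroup (Fin 2 × ℤ) := FreeGroup.lift
    ![FreeGroup.of (1, 1) * (FreeGroup.of (1, 0))⁻¹,
      FreeGroup.of (1, 2) * (FreeGroup.of (1, 0))⁻¹]
  let r : FreeGroup (Fin 2 × ℤ) →* FreeGroup (Fin 2) := FreeGroup.lift fun p ↦
    if p.2 = 1 then FreeGroup.of 0 else if p.2 = 2 then FreeGroup.of 1 else 1
  have hr : r.comp s = MonoidHom.id _ := by
    ext i
    fin_cases i <;> simp [r, s]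
  have h1 := splitLetter_conj 1
  have h2 := splitLetter_conj 2
  have h0 := splitLetter_of_ne 0 (by decide : (1 : Fin 2) ≠ 0)
  have hs : (splitLetter (0 : Fin 2)).comp twist = inl.comp s := by
    refine FreeGroup.ext_hom _ _ fun i ↦ ?_
    fin_cases i
    · simp only [Fin.zero_eta, MonoidHom.comp_apply, twist_zero, commutatorElement_def, s,
        FreeGroup.lift_apply_of, Matrix.cons_val_zero]
      rw [map_mul, map_mul inl, map_inv, map_inv, h0]
      rw [pow_one] at h1
      rw [h1]
      rfl
    · simp only [Fin.mk_one, MonoidHom.comp_apply, twist_one, commutatorElement_def, s,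
        FreeGroup.lift_apply_of, Matrix.cons_val_one,
        Matrix.cons_val_fin_one]
      rw [map_mul, map_mul inl, map_inv, map_inv, h0, h2]
      rfl
  have hinj : Function.Injective ((splitLetter (0 : Fin 2)).comp twist) := by
    rw [hs]
    exact inl_injective.comp (Function.LeftInverse.injective (g := r) (DFunLike.congr_fun hr))
  exact Function.Injective.of_comp hinj

lemma norm_twist_le (w : FreeGroup (Fin 2)) : (twist w).norm ≤ 6 * w.norm := by
  refine norm_map_le twist (fun i ↦ ?_) w
  fin_cases i
  · rw [Fin.zero_eta, twist_zero]
    exact FreeGroup.norm_mk_le.trans (by decide)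
  · rw [Fin.mk_one, twist_one]
    exact FreeGroup.norm_mk_le.trans (by decide)

lemma twist_mem_commutator (w : FreeGroup (Fin 2)) :
    twist w ∈ commutator (FreeGroup (Fin 2)) := by
  have h : Abelianization.of.comp twist = 1 := by
    ext i
    fin_cases i <;> simp [twist, commutatorElement_def]
  rw [← Abelianization.ker_of]
  exact DFunLike.congr_fun h w

lemma twist_mem_derivedSeries {w : FreeGroup (Fin 2)} {n : ℕ}
    (hw : w ∈ derivedSeries (FreeGroup (Fin 2)) n) :
    twist w ∈ derivedSeries (FreeGroup (Fin 2)) (n + 1) :=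
  map_derivedSeries_le_succ twist twist_mem_commutator n ⟨w, hw, rfl⟩

lemma lift_twist {G : Type*} [Group G] (g : Fin 2 → G) (w : FreeGroup (Fin 2)) :
    FreeGroup.lift g (twist w) =
      FreeGroup.lift (fun i ↦ FreeGroup.lift g (twist (FreeGroup.of i))) w := by
  have h : (FreeGroup.lift g).comp twist =
      FreeGroup.lift (fun i ↦ FreeGroup.lift g (twist (FreeGroup.of i))) := by
    ext i
    simp
  exact DFunLike.congr_fun h w

lemma lift_twist_of_commute {G : Type*} [Group G] (g : Fin 2 → G) (h : Commute (g 0) (g 1))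
    (w : FreeGroup (Fin 2)) : FreeGroup.lift g (twist w) = 1 := by
  have h1 : (FreeGroup.lift g).comp twist = 1 := by
    ext i
    fin_cases i
    · simpa [twist, commutatorElement_eq_one_iff_commute] using h
    · simpa [twist, commutatorElement_eq_one_iff_commute] using h.pow_left 2
  exact DFunLike.congr_fun h1 w

/-- A free group of finite rank embeds in the free group of rank two. -/
def conjEmbedding (k : ℕ) : FreeGroup (Fin k) →* FreeGroup (Fin 2) :=
  FreeGroup.lift fun i ↦
    FreeGroup.of 0 ^ (i : ℕ) * FreeGroup.of 1 * (FreeGroup.of 0 ^ (i : ℕ))⁻¹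

lemma conjEmbedding_injective (k : ℕ) : Function.Injective (conjEmbedding k) := by
  have hs : (splitLetter (0 : Fin 2)).comp (conjEmbedding k) =
      inl.comp (FreeGroup.map fun i : Fin k ↦ ((1 : Fin 2), ((i : ℕ) : ℤ))) := by
    refine FreeGroup.ext_hom _ _ fun i ↦ ?_
    rw [MonoidHom.comp_apply, conjEmbedding, FreeGroup.lift_apply_of, splitLetter_conj,
      MonoidHom.comp_apply, FreeGroup.map.of]
  have hinj : Function.Injective ((splitLetter (0 : Fin 2)).comp (conjEmbedding k)) := by
    rw [hs]
    refine inl_injective.comp (FreeGroup.map_injective fun i j hij ↦ ?_)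
    simpa [Fin.ext_iff] using hij
  exact Function.Injective.of_comp hinj

/-- The least length of a nontrivial element in the `k`-th derived subgroup of the free group of
rank two. -/
noncomputable def minLen (k : ℕ) : ℕ :=
  sInf {n | ∃ w : FreeGroup (Fin 2),
    w ≠ 1 ∧ w ∈ derivedSeries (FreeGroup (Fin 2)) k ∧ w.norm = n}

lemma exists_ne_one_mem_derivedSeries (k : ℕ) :
    ∃ w : FreeGroup (Fin 2), w ≠ 1 ∧ w ∈ derivedSeries (FreeGroup (Fin 2)) k := by
  induction k with
  | zero => exact ⟨FreeGroup.of 0, FreeGroup.of_ne_one 0, Subgroup.mem_top _⟩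
  | succ k ih =>
    obtain ⟨w, hw, hk⟩ := ih
    exact ⟨twist w, (map_ne_one_iff _ twist_injective).2 hw, twist_mem_derivedSeries hk⟩

lemma exists_norm_eq_minLen (k : ℕ) : ∃ w : FreeGroup (Fin 2),
    w ≠ 1 ∧ w ∈ derivedSeries (FreeGroup (Fin 2)) k ∧ w.norm = minLen k := by
  refine Nat.sInf_mem (s := {n | ∃ w : FreeGroup (Fin 2),
    w ≠ 1 ∧ w ∈ derivedSeries (FreeGroup (Fin 2)) k ∧ w.norm = n}) ?_
  obtain ⟨w, hw, hk⟩ := exists_ne_one_mem_derivedSeries k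
  exact ⟨_, w, hw, hk, rfl⟩

lemma minLen_le {k : ℕ} {w : FreeGroup (Fin 2)} (hw : w ≠ 1)
    (hk : w ∈ derivedSeries (FreeGroup (Fin 2)) k) : minLen k ≤ w.norm :=
  Nat.sInf_le ⟨w, hw, hk, rfl⟩

lemma lt_minLen (k : ℕ) : k < minLen k := by
  obtain ⟨w, hw, hk, hlen⟩ := exists_norm_eq_minLen k
  by_contra! h
  exact hw (eq_one_of_mem_derivedSeries k _ w (hlen.trans_le h) hk)

lemma minLen_zero : minLen 0 = 1 :=
  le_antisymm ((minLen_le (FreeGroup.of_ne_one 0) (Subgroup.mem_top _)).trans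
    (FreeGroup.norm_of _).le) (lt_minLen 0)

lemma minLen_mono : Monotone minLen := by
  intro k m hkm
  obtain ⟨w, hw, hm, hlen⟩ := exists_norm_eq_minLen m
  exact hlen ▸ minLen_le hw (derivedSeries_antitone _ hkm hm)

lemma minLen_succ_le (k : ℕ) : minLen (k + 1) ≤ 6 * minLen k := by
  obtain ⟨w, hw, hk, hlen⟩ := exists_norm_eq_minLen k
  exact hlen ▸ (minLen_le ((map_ne_one_iff _ twist_injective).2 hw)
    (twist_mem_derivedSeries hk)).trans (norm_twist_le w)

lemma exists_minLen_bracket {l : ℕ} (hl : 1 ≤ l) :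
    ∃ m, minLen m ≤ l ∧ l < minLen (m + 1) ∧ minLen (m + 1) ≤ 6 * l := by
  have hex : ∃ n, l < minLen n := ⟨l, lt_minLen l⟩
  classical
  have hspec := Nat.find_spec hex
  obtain ⟨m, hm⟩ : ∃ m, Nat.find hex = m + 1 := by
    refine Nat.exists_eq_succ_of_ne_zero fun h0 ↦ ?_
    rw [h0, minLen_zero] at hspec
    omega
  have hle : minLen m ≤ l := not_lt.1 (Nat.find_min hex (by omega))
  have := minLen_succ_le m
  exact ⟨m, hle, hm ▸ hspec, by omega⟩

/-- The product of the free solvable groups of rank two of all derived lengths. -/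
abbrev SolvProd : Type :=
  ∀ k : ℕ, FreeGroup (Fin 2) ⧸ derivedSeries (FreeGroup (Fin 2)) k

/-- The unrestricted wreath product of `SolvProd` with `ℤ`. -/
abbrev Wreath : Type :=
  (Multiplicative ℤ → SolvProd) ⋊[(mulAutArrow : Multiplicative ℤ →*
    MulAut (Multiplicative ℤ → SolvProd))] Multiplicative ℤ

lemma wreath_mul_left_apply (g h : Wreath) (x : Multiplicative ℤ) :
    (g * h).left x = g.left x * h.left (g.right⁻¹ * x) := rfl

/-- The shift generator. -/
def genT : Wreath := inr (Multiplicative.ofAdd 1)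

/-- The generator whose lamps carry the first free generator, all placed at the origin. -/
def genA : Wreath := inl fun x _ ↦
  if x = 1 then (FreeGroup.of 0 : FreeGroup (Fin 2)) else 1

/-- The generator whose `k`-th lamp carries the second free generator, placed at `q k`. -/
def genB (q : ℕ → ℕ) : Wreath := inl fun x k ↦
  if x = Multiplicative.ofAdd (q k : ℤ) then (FreeGroup.of 1 : FreeGroup (Fin 2)) else 1

/-- The generating set of the group with delays `q`. -/
def genSet (q : ℕ → ℕ) : Set Wreath := {genT, genA, genB q}

/-- The subgroup of lamp values reachable at `x` in the `k`-th coordinate by words of length at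
most `R`. -/
def localGroup (q : ℕ → ℕ) (k R : ℕ) (x : Multiplicative ℤ) :
    Subgroup (FreeGroup (Fin 2) ⧸ derivedSeries (FreeGroup (Fin 2)) k) :=
  Subgroup.closure {d | (|Multiplicative.toAdd x| ≤ R ∧ d = (FreeGroup.of 0 : FreeGroup (Fin 2))) ∨
    (|Multiplicative.toAdd x - q k| ≤ R ∧ d = (FreeGroup.of 1 : FreeGroup (Fin 2)))}

/-- A set containing all elements of word length at most `R`. -/
def coarseBall (q : ℕ → ℕ) (R : ℕ) : Set Wreath :=
  {g | |Multiplicative.toAdd g.right| ≤ R ∧ ∀ x k, g.left x k ∈ localGroup q k R x}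

lemma localGroup_le {q : ℕ → ℕ} {k r s R : ℕ} {x y : Multiplicative ℤ}
    (hxy : |Multiplicative.toAdd x - Multiplicative.toAdd y| ≤ r) (hR : r + s ≤ R) :
    localGroup q k s x ≤ localGroup q k R y := by
  refine Subgroup.closure_mono ?_
  rw [abs_le] at hxy
  rintro d (⟨h, rfl⟩ | ⟨h, rfl⟩)
  · refine Or.inl ⟨?_, rfl⟩
    rw [abs_le] at h ⊢
    omega
  · refine Or.inr ⟨?_, rfl⟩
    rw [abs_le] at h ⊢
    omega

lemma commute_of_mem_localGroup {q : ℕ → ℕ} {k R : ℕ} {x : Multiplicative ℤ}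
    (hR : 2 * R < q k) {d e : FreeGroup (Fin 2) ⧸ derivedSeries (FreeGroup (Fin 2)) k}
    (hd : d ∈ localGroup q k R x) (he : e ∈ localGroup q k R x) : Commute d e := by
  obtain ⟨c, hc⟩ : ∃ c, localGroup q k R x ≤ Subgroup.zpowers c := by
    by_cases hx : |Multiplicative.toAdd x| ≤ R
    · refine ⟨(FreeGroup.of 0 : FreeGroup (Fin 2)), (Subgroup.closure_le _).2 ?_⟩
      rintro d (⟨-, rfl⟩ | ⟨h, rfl⟩)
      · exact Subgroup.mem_zpowers _
      · rw [abs_le] at h hx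
        omega
    · refine ⟨(FreeGroup.of 1 : FreeGroup (Fin 2)), (Subgroup.closure_le _).2 ?_⟩
      rintro d (⟨h, rfl⟩ | ⟨-, rfl⟩)
      · exact absurd h hx
      · exact Subgroup.mem_zpowers _
  obtain ⟨m, rfl⟩ := Subgroup.mem_zpowers_iff.1 (hc hd)
  obtain ⟨n, rfl⟩ := Subgroup.mem_zpowers_iff.1 (hc he)
  exact (Commute.refl c).zpow_zpow m n

lemma one_mem_coarseBall (q : ℕ → ℕ) : (1 : Wreath) ∈ coarseBall q 0 :=
  ⟨by simp, fun _ _ ↦ one_mem _⟩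

lemma coarseBall_mono {q : ℕ → ℕ} {r R : ℕ} (h : r ≤ R) : coarseBall q r ⊆ coarseBall q R := by
  rintro g ⟨hg, hg'⟩
  exact ⟨hg.trans (by exact_mod_cast h),
    fun x k ↦ localGroup_le (r := 0) (by simp) (by omega) (hg' x k)⟩

lemma mul_mem_coarseBall {q : ℕ → ℕ} {r s : ℕ} {g h : Wreath} (hg : g ∈ coarseBall q r)
    (hh : h ∈ coarseBall q s) : g * h ∈ coarseBall q (r + s) := by
  refine ⟨?_, fun x k ↦ ?_⟩
  · rw [mul_right, toAdd_mul]
    refine (abs_add_le _ _).trans ?_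
    push_cast
    exact add_le_add hg.1 hh.1
  · rw [wreath_mul_left_apply, Pi.mul_apply]
    refine mul_mem (localGroup_le (r := 0) (by simp) (by omega) (hg.2 x k))
      (localGroup_le (r := r) ?_ le_rfl (hh.2 _ k))
    simpa using hg.1

lemma gen_mem_coarseBall {q : ℕ → ℕ} {g : Wreath} (hg : g ∈ genSet q ∨ g⁻¹ ∈ genSet q) :
    g ∈ coarseBall q 1 := by
  have hA : ∀ x k, (genA).left x k ∈ localGroup q k 1 x := by
    intro x k
    by_cases hx : x = 1
    · simp only [genA, left_inl, hx, if_true]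
      exact Subgroup.subset_closure (Or.inl ⟨by simp, rfl⟩)
    · simp only [genA, left_inl, hx, if_false]
      exact one_mem _
  have hB : ∀ x k, (genB q).left x k ∈ localGroup q k 1 x := by
    intro x k
    by_cases hx : x = Multiplicative.ofAdd (q k : ℤ)
    · simp only [genB, left_inl, hx, if_true]
      exact Subgroup.subset_closure (Or.inr ⟨by simp, rfl⟩)
    · simp only [genB, left_inl, hx, if_false]
      exact one_mem _
  rcases hg with (rfl | rfl | rfl) | h
  · exact ⟨by simp [genT], fun _ _ ↦ one_mem _⟩
  · exact ⟨by simp [genA], hA⟩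
  · exact ⟨by simp [genB], hB⟩
  · obtain ⟨g', rfl⟩ : ∃ g', g = g'⁻¹ := ⟨g⁻¹, (inv_inv g).symm⟩
    rw [inv_inv] at h
    rcases h with rfl | rfl | rfl
    · rw [genT, ← map_inv]
      exact ⟨by simp, fun _ _ ↦ one_mem _⟩
    · refine ⟨by simp [genA], fun x k ↦ ?_⟩
      rw [genA, ← map_inv]
      exact inv_mem (hA x k)
    · refine ⟨by simp [genB], fun x k ↦ ?_⟩
      rw [genB, ← map_inv]
      exact inv_mem (hB x k)

lemma lift_mem_coarseBall {q : ℕ → ℕ} {c : ℕ} {g : Fin 2 → Wreath}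
    (hg : ∀ i, g i ∈ coarseBall q c ∧ (g i)⁻¹ ∈ coarseBall q c) (w : FreeGroup (Fin 2)) :
    FreeGroup.lift g w ∈ coarseBall q (w.norm * c) := by
  suffices h : ∀ L : List (Fin 2 × Bool),
      FreeGroup.lift g (FreeGroup.mk L) ∈ coarseBall q (L.length * c) by
    have := h w.toWord
    rwa [FreeGroup.mk_toWord] at this
  intro L
  rw [FreeGroup.lift_mk]
  induction L with
  | nil => simpa using one_mem_coarseBall q
  | cons p L ih =>
    obtain ⟨i, b⟩ := p
    rw [List.map_cons, List.prod_cons, List.length_cons, add_mul, one_mul, add_comm]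
    refine mul_mem_coarseBall ?_ ih
    cases b
    · exact (hg i).2
    · exact (hg i).1

/-- If `g` takes values in the base group then words may be evaluated lamp by lamp. -/
lemma lift_inl_apply (f : Fin 2 → Multiplicative ℤ → SolvProd) (w : FreeGroup (Fin 2))
    (x : Multiplicative ℤ) (k : ℕ) :
    (FreeGroup.lift f w) x k = FreeGroup.lift (fun i ↦ f i x k) w := by
  have h : ((Pi.evalMonoidHom _ k).comp (Pi.evalMonoidHom _ x)).comp (FreeGroup.lift f) =
      FreeGroup.lift fun i ↦ f i x k := by
    ext i
    simp
  exact DFunLike.congr_fun h w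

lemma lift_map {N G : Type*} [Group N] [Group G] (φ : N →* G) (f : Fin 2 → N)
    (w : FreeGroup (Fin 2)) : FreeGroup.lift (fun i ↦ φ (f i)) w = φ (FreeGroup.lift f w) := by
  have h : FreeGroup.lift (fun i ↦ φ (f i)) = φ.comp (FreeGroup.lift f) := by
    ext i
    simp
  exact DFunLike.congr_fun h w

lemma lift_quotient_derivedSeries_eq_one {k : ℕ} {w : FreeGroup (Fin 2)}
    (hw : w ∈ derivedSeries (FreeGroup (Fin 2)) k)
    (f : Fin 2 → FreeGroup (Fin 2) ⧸ derivedSeries (FreeGroup (Fin 2)) k) :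
    FreeGroup.lift f w = 1 := by
  have h := map_derivedSeries_le_derivedSeries (FreeGroup.lift f) k ⟨w, hw, rfl⟩
  rw [← map_derivedSeries_eq (QuotientGroup.mk'_surjective
    (derivedSeries (FreeGroup (Fin 2)) k)) k] at h
  obtain ⟨v, hv, hvw⟩ := h
  rw [← hvw]
  exact (QuotientGroup.eq_one_iff v).2 hv

/-- Elements that are short compared with all the delays beyond `m` satisfy a law coming from the
derived series. -/
lemma lift_twist_twist_eq_one {q : ℕ → ℕ} {m c : ℕ} (hq : ∀ k, m < k → 12 * c < q k)
    {g : Fin 2 → Wreath} (hg : ∀ i, g i ∈ coarseBall q c ∧ (g i)⁻¹ ∈ coarseBall q c)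
    {v : FreeGroup (Fin 2)} (hv : v ∈ derivedSeries (FreeGroup (Fin 2)) m) :
    FreeGroup.lift g (twist (twist v)) = 1 := by
  let u : Fin 2 → Wreath := fun i ↦ FreeGroup.lift g (twist (FreeGroup.of i))
  have hu : ∀ i, u i ∈ coarseBall q (6 * c) := fun i ↦ by
    refine coarseBall_mono (Nat.mul_le_mul_right c ?_) (lift_mem_coarseBall hg _)
    simpa using norm_twist_le (FreeGroup.of i)
  have hur : ∀ i, u i = inl (u i).left := fun i ↦ by
    have h1 : (u i).right = 1 := by
      have h2 : (rightHom.comp (FreeGroup.lift g)).comp twist = 1 := by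
        ext j
        fin_cases j <;> simp [twist, commutatorElement_def]
      exact DFunLike.congr_fun h2 (FreeGroup.of i)
    ext1
    · simp
    · simpa using h1
  rw [lift_twist]
  change FreeGroup.lift u (twist v) = 1
  rw [show FreeGroup.lift u = FreeGroup.lift fun i ↦ inl (u i).left from
    congrArg _ (funext hur), lift_map, ← map_one inl]
  congr 1
  ext x k
  rw [lift_inl_apply]
  rcases le_or_gt k m with hk | hk
  · exact lift_quotient_derivedSeries_eq_one
      (derivedSeries_antitone _ (by omega : k ≤ m + 1) (twist_mem_derivedSeries hv)) _
  · refine lift_twist_of_commute _ (commute_of_mem_localGroup (R := 6 * c) ?_ ((hu 0).2 x k)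
      ((hu 1).2 x k)) v
    have := hq k hk
    omega

section WordLength

variable {Γ : Type*} [Group Γ] {S : Set Γ}

lemma wlen_prod_le (L : List Γ) (hL : ∀ s ∈ L, s ∈ S ∨ s⁻¹ ∈ S) : wlen S L.prod ≤ L.length :=
  Nat.sInf_le ⟨L.get, fun i ↦ hL _ (L.get_mem i), by rw [List.ofFn_get]⟩

lemma exists_list_length_eq_wlen (hS : Subgroup.closure S = ⊤) (g : Γ) :
    ∃ L : List Γ, (∀ s ∈ L, s ∈ S ∨ s⁻¹ ∈ S) ∧ L.prod = g ∧ L.length = wlen S g := by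
  have hne : {n | ∃ f : Fin n → Γ,
      (∀ i, f i ∈ S ∨ (f i)⁻¹ ∈ S) ∧ (List.ofFn f).prod = g}.Nonempty := by
    have hg : g ∈ Submonoid.closure (S ∪ S⁻¹) := by
      rw [← Subgroup.closure_toSubmonoid, hS]
      exact Subgroup.mem_top g
    obtain ⟨L, hL, rfl⟩ := Submonoid.exists_list_of_mem_closure hg
    exact ⟨L.length, L.get, fun i ↦ hL _ (L.get_mem i), by rw [List.ofFn_get]⟩
  obtain ⟨f, hf, hfg⟩ := Nat.sInf_mem hne
  refine ⟨List.ofFn f, fun s hs ↦ ?_, hfg, List.length_ofFn⟩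
  obtain ⟨i, rfl⟩ := List.mem_ofFn.1 hs
  exact hf i

lemma chi_le {k : ℕ} {w : FreeGroup (Fin k)} {g : Fin k → Γ} (hg : FreeGroup.lift g w ≠ 1) :
    chi S w ≤ ∑ i, wlen S (g i) :=
  Nat.sInf_le ⟨g, hg, rfl⟩

lemma exists_chi_eq {k : ℕ} {w : FreeGroup (Fin k)} (hw : ¬ IsLaw Γ w) :
    ∃ g : Fin k → Γ, FreeGroup.lift g w ≠ 1 ∧ chi S w = ∑ i, wlen S (g i) := by
  obtain ⟨g, hg⟩ := not_forall.1 hw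
  exact Nat.sInf_mem (s := {c | ∃ g : Fin k → Γ,
    FreeGroup.lift g w ≠ 1 ∧ c = ∑ i, wlen S (g i)}) ⟨_, g, hg, rfl⟩

lemma chi_le_lawGrowth {l : ℕ} {w : FreeGroup (Fin 2)} (hw : w ≠ 1) (hl : wordLen w ≤ l) :
    chi S w ≤ lawGrowth S l := by
  refine le_csSup (Set.Finite.bddAbove ?_) ⟨w, hw, hl, rfl⟩
  have hfin : {w : FreeGroup (Fin 2) | wordLen w ≤ l}.Finite :=
    Set.Finite.of_finite_image ((List.finite_length_le (Fin 2 × Bool) l).subset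
      (by rintro _ ⟨w, hw, rfl⟩; exact hw)) FreeGroup.toWord_injective.injOn
  refine (hfin.image (chi S)).subset ?_
  rintro _ ⟨w, -, hw, rfl⟩
  exact ⟨w, hw, rfl⟩

lemma lawGrowth_le {l N : ℕ}
    (h : ∀ w : FreeGroup (Fin 2), w ≠ 1 → wordLen w ≤ l → chi S w ≤ N) : lawGrowth S l ≤ N := by
  refine csSup_le' ?_
  rintro _ ⟨w, hw, hl, rfl⟩
  exact h w hw hl

lemma isLawless_of_rank_two (h : ∀ w : FreeGroup (Fin 2), w ≠ 1 → ¬ IsLaw Γ w) :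
    IsLawless Γ := by
  intro k w hw hlaw
  refine h (conjEmbedding k w) ((map_ne_one_iff _ (conjEmbedding_injective k)).2 hw) fun g ↦ ?_
  have hc : (FreeGroup.lift g).comp (conjEmbedding k) =
      FreeGroup.lift fun i ↦ FreeGroup.lift g (conjEmbedding k (FreeGroup.of i)) := by
    ext i
    simp
  exact (DFunLike.congr_fun hc w).trans (hlaw _)

end WordLength

/-- The group generated by `genSet q`. -/
abbrev DelayGroup (q : ℕ → ℕ) : Type := Subgroup.closure (genSet q)

/-- The standard generating set of `DelayGroup q`. -/
def delayGens (q : ℕ → ℕ) : Set (DelayGroup q) := Subtype.val ⁻¹' genSet q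

lemma delayGens_finite (q : ℕ → ℕ) : (delayGens q).Finite :=
  Set.Finite.preimage Subtype.val_injective.injOn (by simp [genSet])

lemma closure_delayGens (q : ℕ → ℕ) : Subgroup.closure (delayGens q) = ⊤ :=
  Subgroup.closure_closure_coe_preimage

lemma prod_mem_coarseBall {q : ℕ → ℕ} (L : List (DelayGroup q))
    (hL : ∀ s ∈ L, s ∈ delayGens q ∨ s⁻¹ ∈ delayGens q) :
    (L.prod : Wreath) ∈ coarseBall q L.length ∧ (L.prod : Wreath)⁻¹ ∈ coarseBall q L.length := by
  induction L with
  | nil => simpa using one_mem_coarseBall q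
  | cons s L ih =>
    obtain ⟨h1, h2⟩ := ih fun t ht ↦ hL t (List.mem_cons_of_mem _ ht)
    have hs : (s : Wreath) ∈ genSet q ∨ (s : Wreath)⁻¹ ∈ genSet q := hL s List.mem_cons_self
    rw [List.prod_cons, List.length_cons, Subgroup.coe_mul, mul_inv_rev]
    refine ⟨?_, mul_mem_coarseBall h2 (gen_mem_coarseBall ?_)⟩
    · rw [add_comm]
      exact mul_mem_coarseBall (gen_mem_coarseBall hs) h1
    · rw [inv_inv]
      exact hs.symm

lemma mem_coarseBall_of_wlen_le {q : ℕ → ℕ} {g : DelayGroup q} {c : ℕ}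
    (hg : wlen (delayGens q) g ≤ c) :
    (g : Wreath) ∈ coarseBall q c ∧ (g : Wreath)⁻¹ ∈ coarseBall q c := by
  obtain ⟨L, hL, rfl, hlen⟩ := exists_list_length_eq_wlen (closure_delayGens q) g
  have h := prod_mem_coarseBall L hL
  exact ⟨coarseBall_mono (hlen.trans_le hg) h.1, coarseBall_mono (hlen.trans_le hg) h.2⟩

lemma coe_lift {q : ℕ → ℕ} (g : Fin 2 → DelayGroup q) (w : FreeGroup (Fin 2)) :
    FreeGroup.lift (fun i ↦ (g i : Wreath)) w = (FreeGroup.lift g w : DelayGroup q) :=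
  lift_map (Subgroup.subtype _) g w

/-- Words outside the `n`-th derived subgroup are detected by elements of length comparable with
the `n`-th delay. -/
lemma exists_lift_ne_one (q : ℕ → ℕ) {n : ℕ} {w : FreeGroup (Fin 2)}
    (hw : w ∉ derivedSeries (FreeGroup (Fin 2)) n) :
    ∃ g : Fin 2 → DelayGroup q, FreeGroup.lift g w ≠ 1 ∧
      ∑ i, wlen (delayGens q) (g i) ≤ 2 * q n + 2 := by
  let t : DelayGroup q := ⟨genT, Subgroup.subset_closure (by simp [genSet])⟩
  let a : DelayGroup q := ⟨genA, Subgroup.subset_closure (by simp [genSet])⟩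
  let b : DelayGroup q := ⟨genB q, Subgroup.subset_closure (by simp [genSet])⟩
  have ht : t ∈ delayGens q := Or.inl rfl
  have ha : a ∈ delayGens q := Or.inr (Or.inl rfl)
  have hb : b ∈ delayGens q := Or.inr (Or.inr rfl)
  let L : List (DelayGroup q) := List.replicate (q n) t⁻¹ ++ (b :: List.replicate (q n) t)
  have hL : L.prod = (t ^ q n)⁻¹ * b * t ^ q n := by
    simp [L, mul_assoc]
  refine ⟨![a, L.prod], fun h1 ↦ hw ?_, ?_⟩
  · let f : Fin 2 → Multiplicative ℤ → SolvProd := ![(genA).left,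
      fun x ↦ (genB q).left (Multiplicative.ofAdd (q n : ℤ) * x)]
    have hf : (fun i ↦ ((![a, L.prod] i : DelayGroup q) : Wreath)) = fun i ↦ inl (f i) := by
      funext i
      fin_cases i
      · rfl
      · have h2 := inl_aut_inv (φ := (mulAutArrow : Multiplicative ℤ →*
          MulAut (Multiplicative ℤ → SolvProd))) (Multiplicative.ofAdd (q n : ℤ)) (genB q).left
        have h3 : (genT ^ q n : Wreath) = inr (Multiplicative.ofAdd (q n : ℤ)) := by
          rw [genT, ← map_pow, ← ofAdd_nsmul]
          simp
        have h4 : ((L.prod : DelayGroup q) : Wreath) = (genT ^ q n)⁻¹ * genB q * genT ^ q n := by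
          rw [hL]
          rfl
        change ((L.prod : DelayGroup q) : Wreath) = inl (f 1)
        rw [h4, h3, ← map_inv]
        refine Eq.trans ?_ (h2.symm.trans ?_)
        · rfl
        · rw [← map_inv]
          congr 1
          ext x k
          change (genB q).left ((Multiplicative.ofAdd (q n : ℤ))⁻¹⁻¹ * x) k = _
          rw [inv_inv]
          rfl
    have h2 := coe_lift ![a, L.prod] w
    rw [h1, hf, lift_map, Subgroup.coe_one, ← map_one inl] at h2
    have h3 := congrFun (congrFun (inl_injective h2) 1) n
    rw [lift_inl_apply] at h3
    have h4 : (fun i ↦ f i 1 n) = fun i ↦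
        QuotientGroup.mk' (derivedSeries (FreeGroup (Fin 2)) n) (FreeGroup.of i) := by
      funext i
      fin_cases i <;> simp [f, genA, genB]
    rw [h4, lift_map, FreeGroup.lift_of_apply] at h3
    exact (QuotientGroup.eq_one_iff w).1 h3
  · have h1 : wlen (delayGens q) a ≤ 1 := by
      simpa using wlen_prod_le (S := delayGens q) [a] (by simp [ha])
    have h2 : wlen (delayGens q) L.prod ≤ 2 * q n + 1 := by
      refine (wlen_prod_le L fun s hs ↦ ?_).trans (by simp [L]; omega)
      rcases List.mem_append.1 hs with hs | hs
      · rw [List.eq_of_mem_replicate hs, inv_inv]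
        exact Or.inr ht
      · rcases List.mem_cons.1 hs with rfl | hs
        · exact Or.inl hb
        · rw [List.eq_of_mem_replicate hs]
          exact Or.inl ht
    simp only [Fin.sum_univ_two, Matrix.cons_val_zero, Matrix.cons_val_one]
    omega

lemma not_isLaw_delayGroup (q : ℕ → ℕ) (w : FreeGroup (Fin 2)) (hw : w ≠ 1) :
    ¬ IsLaw (DelayGroup q) w := by
  intro h
  obtain ⟨g, hg, -⟩ := exists_lift_ne_one q
    (mt (eq_one_of_mem_derivedSeries w.norm (Fin 2) w le_rfl) hw)
  exact hg (h g)

end LawlessGrowth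

open LawlessGrowth

/-- If `f` is unbounded, nondecreasing, and `f(Mn) ≥ 9f(n)` for some
constant `M` and all `n`, then there is a lawless group `Γ` generated by a finite set `S`
with `𝒜_Γ^S ≈ f`. -/
theorem stmt1 (f : ℕ → ℕ)
    (hmono : ∀ ⦃m n : ℕ⦄, 1 ≤ m → m ≤ n → f m ≤ f n)
    (hunb : ∀ N : ℕ, ∃ n : ℕ, 1 ≤ n ∧ N ≤ f n)
    (hM : ∃ M : ℕ, 1 ≤ M ∧ ∀ n : ℕ, 1 ≤ n → 9 * f n ≤ f (M * n)) :
    ∃ (Γ : Type) (_ : Group Γ) (S : Set Γ),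
      S.Finite ∧ Subgroup.closure S = ⊤ ∧ IsLawless Γ ∧ EquivGrowth (lawGrowth S) f := by
  obtain ⟨n₀, hn₀, hfn₀⟩ := hunb 1
  let q : ℕ → ℕ := fun k ↦ f (minLen k)
  have hmin (k : ℕ) : 1 ≤ minLen k := (Nat.succ_le_succ (Nat.zero_le k)).trans (lt_minLen k)
  refine ⟨DelayGroup q, inferInstance, delayGens q, delayGens_finite q, closure_delayGens q,
    isLawless_of_rank_two (not_isLaw_delayGroup q), ⟨6 + n₀, by omega, fun l hl ↦ ?_⟩,
    ⟨36, by norm_num, fun l hl ↦ ?_⟩⟩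
  · obtain ⟨m, -, hlt, hle⟩ := exists_minLen_bracket hl
    have h1 : f n₀ ≤ f ((6 + n₀) * l) := hmono hn₀ (by nlinarith)
    have h2 : q (m + 1) ≤ f ((6 + n₀) * l) := hmono (hmin _) (hle.trans (by nlinarith))
    refine (lawGrowth_le fun w hw hwl ↦ ?_).trans
      (by nlinarith : 2 * q (m + 1) + 2 ≤ (6 + n₀) * f ((6 + n₀) * l))
    obtain ⟨g, hg, hlen⟩ := exists_lift_ne_one q
      (fun hmem ↦ absurd (minLen_le hw hmem) (not_le.2 (lt_of_le_of_lt hwl hlt)))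
    exact (chi_le hg).trans hlen
  · obtain ⟨m, hle, hlt, -⟩ := exists_minLen_bracket hl
    obtain ⟨v, hv, hmem, hlen⟩ := exists_norm_eq_minLen m
    have hw : twist (twist v) ≠ 1 := (map_ne_one_iff _ twist_injective).2
      ((map_ne_one_iff _ twist_injective).2 hv)
    have hwl : wordLen (twist (twist v)) ≤ 36 * l := by
      have h1 := norm_twist_le (twist v)
      have h2 := norm_twist_le v
      change (twist (twist v)).norm ≤ 36 * l
      omega
    obtain ⟨g, hg, hchi⟩ := exists_chi_eq (S := delayGens q) (not_isLaw_delayGroup q _ hw)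
    have hq : q (m + 1) ≤ 12 * chi (delayGens q) (twist (twist v)) := by
      by_contra! hcon
      have h1 := lift_twist_twist_eq_one (q := q) (g := fun i ↦ (g i : Wreath))
        (fun k hk ↦ hcon.trans_le (hmono (hmin _) (minLen_mono hk)))
        (fun i ↦ mem_coarseBall_of_wlen_le (hchi ▸ Finset.single_le_sum
          (f := fun i ↦ wlen (delayGens q) (g i)) (fun _ _ ↦ Nat.zero_le _) (Finset.mem_univ i)))
        hmem
      rw [coe_lift] at h1
      exact hg (Subtype.ext h1)
    have h1 : f l ≤ q (m + 1) := hmono hl hlt.le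
    have h2 := chi_le_lawGrowth (S := delayGens q) hw hwl
    omega
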